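/- arXiv:2605.09389 — 3 statements merged into one kernel-verified Lean document; each statement's English description precedes it below -/
import Mathlib

section
/- Let H be a complex Hilbert space and for each j ∈ ℤ let (g_{j,k})_{k∈ℕ} be a sequence in H. Assume: (1) (monotonicity) for every f ∈ H and every j ∈ ℤ, ∑_{k∈ℕ} |⟨f, g_{j−1,k}⟩|² ≤ ∑_{k∈ℕ} |⟨f, g_{j,k}⟩|² (as elements of [0,∞]); and (2) there is a dense subset V ⊆ H such that for every f ∈ V and every ε > 0 there exists j ≥ 0 with ∑_{k∈ℕ} |⟨f, g_{j,k}⟩|² ≤ (1+ε)‖f‖². Then (g_{0,k})_{k∈ℕ} is a Bessel sequence with bound 1: ∑_{k∈ℕ} |⟨f, g_{0,k}⟩|² ≤ ‖f‖² for every f ∈ H. -/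
open scoped InnerProductSpace ENNReal

/-- A bound by `‖f‖²` on the square sums of the coefficients of `f` extends from a dense set to
the whole space. -/
theorem tsum_inner_sq_le_of_dense {ι H : Type*} [NormedAddCommGroup H]
    [InnerProductSpace ℂ H] (g : ι → H) {V : Set H} (hV : Dense V)
    (h : ∀ f ∈ V, ∑' k, ((‖⟪f, g k⟫_ℂ‖₊ : ℝ≥0∞) ^ 2) ≤ (‖f‖₊ : ℝ≥0∞) ^ 2) (f : H) :
    ∑' k, ((‖⟪f, g k⟫_ℂ‖₊ : ℝ≥0∞) ^ 2) ≤ (‖f‖₊ : ℝ≥0∞) ^ 2 := by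
  rw [ENNReal.tsum_eq_iSup_sum]
  refine iSup_le fun s => ?_
  have hclosed : IsClosed {f : H | ∑ k ∈ s, ‖⟪f, g k⟫_ℂ‖₊ ^ 2 ≤ ‖f‖₊ ^ 2} :=
    isClosed_le (by fun_prop) (by fun_prop)
  have hsub : V ⊆ {f : H | ∑ k ∈ s, ‖⟪f, g k⟫_ℂ‖₊ ^ 2 ≤ ‖f‖₊ ^ 2} := fun x hx => by
    have := (ENNReal.sum_le_tsum s).trans (h x hx)
    exact_mod_cast this
  have hf := hclosed.closure_subset_iff.2 hsub (hV f)
  exact_mod_cast hf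

/-- To prove `a ≤ c` in `ℝ≥0∞` it suffices to prove `a ≤ (1 + ε) c` for all real `ε > 0`. -/
theorem ENNReal.le_of_forall_pos_le_one_add_mul {a c : ℝ≥0∞} (hc : c ≠ ∞)
    (h : ∀ ε : ℝ, 0 < ε → a ≤ ENNReal.ofReal (1 + ε) * c) : a ≤ c := by
  have hcont : Continuous fun ε : ℝ => ENNReal.ofReal (1 + ε) * c :=
    (ENNReal.continuous_mul_const hc).comp (ENNReal.continuous_ofReal.comp (by fun_prop))
  have hlim : Filter.Tendsto (fun ε : ℝ => ENNReal.ofReal (1 + ε) * c)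
      (nhdsWithin 0 (Set.Ioi 0)) (nhds c) := by
    simpa using (hcont.tendsto 0).mono_left nhdsWithin_le_nhds
  exact ge_of_tendsto hlim (Filter.eventually_of_mem self_mem_nhdsWithin h)

/-- If the level sums are monotone in `j` and on a dense subset the level-`j`
sum is eventually bounded by `(1+ε)‖f‖²` for some `j ≥ 0`, then the level-`0` family is a
Bessel sequence with bound `1`. -/
theorem bessel_bound_one_of_mono_of_dense {H : Type*} [NormedAddCommGroup H]
    [InnerProductSpace ℂ H] [CompleteSpace H] (g : ℤ → ℕ → H)
    (hmono : ∀ f : H, ∀ j : ℤ,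
      ∑' k : ℕ, ((‖⟪f, g (j - 1) k⟫_ℂ‖₊ : ℝ≥0∞) ^ 2) ≤
        ∑' k : ℕ, ((‖⟪f, g j k⟫_ℂ‖₊ : ℝ≥0∞) ^ 2))
    (V : Set H) (hV : Dense V)
    (hnear : ∀ f ∈ V, ∀ ε : ℝ, 0 < ε → ∃ j : ℤ, 0 ≤ j ∧
      ∑' k : ℕ, ((‖⟪f, g j k⟫_ℂ‖₊ : ℝ≥0∞) ^ 2) ≤
        ENNReal.ofReal (1 + ε) * (‖f‖₊ : ℝ≥0∞) ^ 2) :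
    ∀ f : H, ∑' k : ℕ, ((‖⟪f, g 0 k⟫_ℂ‖₊ : ℝ≥0∞) ^ 2) ≤ (‖f‖₊ : ℝ≥0∞) ^ 2 := by
  refine tsum_inner_sq_le_of_dense (g 0) hV fun f hf => ?_
  have hM : Monotone fun j : ℤ => ∑' k : ℕ, ((‖⟪f, g j k⟫_ℂ‖₊ : ℝ≥0∞) ^ 2) :=
    monotone_int_of_le_succ fun j => by simpa using hmono f (j + 1)
  refine ENNReal.le_of_forall_pos_le_one_add_mul (by simp) fun ε hε => ?_
  obtain ⟨j, hj, hle⟩ := hnear f hf ε hε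
  exact (hM hj).trans hle
end

section
/- Let H be a complex Hilbert space, let L ≥ 1 be an integer, and for each j ∈ ℤ let (g_{j,k})_{k∈ℕ} be a sequence in H and, for each ℓ ∈ {1,…,L}, let (h_{j,ℓ,k})_{k∈ℕ} be a sequence in H. Assume: (i) for every f ∈ H and every j ∈ ℤ, ∑_{k∈ℕ} |⟨f, g_{j,k}⟩|² = ∑_{k∈ℕ} |⟨f, g_{j−1,k}⟩|² + ∑_{ℓ=1}^{L} ∑_{k∈ℕ} |⟨f, h_{j−1,ℓ,k}⟩|² (in [0,∞]); (ii) there is a dense subset V ⊆ H such that for every f ∈ V and every ε > 0 there exists J ∈ ℤ with (1−ε)‖f‖² ≤ ∑_{k∈ℕ} |⟨f, g_{j,k}⟩|² ≤ (1+ε)‖f‖² for all j ≥ J; and (iii) for every f ∈ H, ∑_{k∈ℕ} |⟨f, g_{j,k}⟩|² → 0 as j → −∞. Then the combined family (h_{j,ℓ,k})_{j∈ℤ, 1≤ℓ≤L, k∈ℕ} is a Parseval frame for H: ∑_{j∈ℤ} ∑_{ℓ=1}^{L} ∑_{k∈ℕ} |⟨f, h_{j,ℓ,k}⟩|² = ‖f‖²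 for every f ∈ H. -/
open scoped InnerProductSpace ENNReal
open Filter

/-- Peter-Paul inequality for squared extended norms. -/
theorem enorm_sq_add_le {E : Type*} [SeminormedAddCommGroup E] (x y : E) {δ : NNReal}
    (hδ : 0 < δ) :
    ‖x + y‖ₑ ^ 2 ≤ ((1 + δ : NNReal) : ℝ≥0∞) * ‖x‖ₑ ^ 2 +
      ((1 + δ⁻¹ : NNReal) : ℝ≥0∞) * ‖y‖ₑ ^ 2 := by
  simp only [enorm_eq_nnnorm]
  norm_cast
  refine (pow_le_pow_left' (nnnorm_add_le x y) 2).trans ?_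
  rw [← NNReal.coe_le_coe]
  push_cast
  have hδ' : (0 : ℝ) < δ := hδ
  have key : (1 + (δ : ℝ)) * ‖x‖ ^ 2 + (1 + (δ : ℝ)⁻¹) * ‖y‖ ^ 2 - (‖x‖ + ‖y‖) ^ 2 =
      (δ : ℝ)⁻¹ * (δ * ‖x‖ - ‖y‖) ^ 2 := by
    field_simp
    ring
  have : 0 ≤ (δ : ℝ)⁻¹ * (δ * ‖x‖ - ‖y‖) ^ 2 := by positivity
  linarith

section FrameEnergy

variable {ι H : Type*} [NormedAddCommGroup H] [InnerProductSpace ℂ H]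

/-- The frame energy `∑ |⟨f, e i⟩|²` satisfies a Peter-Paul inequality. -/
theorem tsum_enorm_inner_sq_add_le (e : ι → H) (x y : H) {δ : NNReal} (hδ : 0 < δ) :
    ∑' i, ‖⟪x + y, e i⟫_ℂ‖ₑ ^ 2 ≤
      ((1 + δ : NNReal) : ℝ≥0∞) * ∑' i, ‖⟪x, e i⟫_ℂ‖ₑ ^ 2 +
        ((1 + δ⁻¹ : NNReal) : ℝ≥0∞) * ∑' i, ‖⟪y, e i⟫_ℂ‖ₑ ^ 2 := by
  rw [← ENNReal.tsum_mul_left, ← ENNReal.tsum_mul_left, ← ENNReal.tsum_add]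
  refine ENNReal.tsum_le_tsum fun i => ?_
  rw [inner_add_left]
  exact enorm_sq_add_le _ _ hδ

/-- A Bessel bound on a dense subset holds everywhere. -/
theorem tsum_enorm_inner_sq_le_of_dense (e : ι → H) {V : Set H} (hV : Dense V)
    (hb : ∀ v ∈ V, ∑' i, ‖⟪v, e i⟫_ℂ‖ₑ ^ 2 ≤ ‖v‖ₑ ^ 2) (f : H) :
    ∑' i, ‖⟪f, e i⟫_ℂ‖ₑ ^ 2 ≤ ‖f‖ₑ ^ 2 := by
  rw [ENNReal.tsum_eq_iSup_sum]
  refine iSup_le fun s => ?_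
  have hclosed : IsClosed {x : H | ∑ i ∈ s, ‖⟪x, e i⟫_ℂ‖ₑ ^ 2 ≤ ‖x‖ₑ ^ 2} := by
    refine isClosed_le (continuous_finsetSum _ fun i _ => ?_) ?_
    · exact (ENNReal.continuous_pow 2).comp
        (continuous_enorm.comp (continuous_id.inner continuous_const))
    · exact (ENNReal.continuous_pow 2).comp continuous_enorm
  exact hclosed.closure_subset_iff.2
    (fun v hv => (ENNReal.sum_le_tsum s).trans (hb v hv)) (hV f)

/-- If the supremum of a family of frame energies is the squared norm on a dense subset, then it
is the squared norm everywhere. -/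
theorem iSup_tsum_enorm_inner_sq_eq_of_dense {κ : Type*} (e : κ → ι → H) {V : Set H}
    (hV : Dense V) (hs : ∀ v ∈ V, ⨆ j, ∑' i, ‖⟪v, e j i⟫_ℂ‖ₑ ^ 2 = ‖v‖ₑ ^ 2) (f : H) :
    ⨆ j, ∑' i, ‖⟪f, e j i⟫_ℂ‖ₑ ^ 2 = ‖f‖ₑ ^ 2 := by
  have hb : ∀ j x, ∑' i, ‖⟪x, e j i⟫_ℂ‖ₑ ^ 2 ≤ ‖x‖ₑ ^ 2 := fun j =>
    tsum_enorm_inner_sq_le_of_dense (e j) hV fun v hv =>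
      (le_iSup (fun j => ∑' i, ‖⟪v, e j i⟫_ℂ‖ₑ ^ 2) j).trans (hs v hv).le
  refine le_antisymm (iSup_le fun j => hb j f) ?_
  set T := ⨆ j, ∑' i, ‖⟪f, e j i⟫_ℂ‖ₑ ^ 2 with hT
  have hδ : ∀ δ : NNReal, 0 < δ → ‖f‖ₑ ^ 2 ≤ ((1 + δ : NNReal) : ℝ≥0∞) * T := by
    intro δ hδ
    have hclosed : IsClosed {x : H | ‖x‖ₑ ^ 2 ≤ ((1 + δ : NNReal) : ℝ≥0∞) * T +
        ((1 + δ⁻¹ : NNReal) : ℝ≥0∞) * ‖x - f‖ₑ ^ 2} := by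
      refine isClosed_le ((ENNReal.continuous_pow 2).comp continuous_enorm) ?_
      exact continuous_const.add ((ENNReal.continuous_const_mul ENNReal.coe_ne_top).comp
        ((ENNReal.continuous_pow 2).comp
          (continuous_enorm.comp (continuous_id.sub continuous_const))))
    have hf := hclosed.closure_subset_iff.2 (fun v hv => ?_) (hV f)
    · simpa using hf
    · change ‖v‖ₑ ^ 2 ≤ _
      rw [← hs v hv]
      refine iSup_le fun j => ?_
      have := tsum_enorm_inner_sq_add_le (e j) f (v - f) hδ
      rw [add_sub_cancel] at this
      refine this.trans ?_
      gcongr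
      · exact le_iSup (fun j => ∑' i, ‖⟪f, e j i⟫_ℂ‖ₑ ^ 2) j
      · exact hb j _
  have hTtop : T ≠ ∞ :=
    ((iSup_le fun j => hb j f).trans_lt (ENNReal.pow_lt_top enorm_lt_top)).ne
  have hlim : Tendsto (fun δ : NNReal => ((1 + δ : NNReal) : ℝ≥0∞) * T)
      (nhdsWithin 0 (Set.Ioi 0)) (nhds T) := by
    have hc : Continuous fun δ : NNReal => ((1 + δ : NNReal) : ℝ≥0∞) * T :=
      (ENNReal.continuous_mul_const hTtop).comp
        (ENNReal.continuous_coe.comp (continuous_const.add continuous_id))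
    simpa using (hc.tendsto 0).mono_left nhdsWithin_le_nhds
  exact ge_of_tendsto hlim (eventually_mem_nhdsWithin.mono hδ)

end FrameEnergy

/-- Iterating a one-step recursion over `ℤ`. -/
theorem add_sum_Ico_eq_of_succ {M : Type*} [AddCommMonoid M] {G b : ℤ → M}
    (hG : ∀ j, G (j + 1) = G j + b j) {m n : ℤ} (hmn : m ≤ n) :
    G m + ∑ i ∈ Finset.Ico m n, b i = G n := by
  induction n, hmn using Int.leInduction with
  | base => simp
  | succ n hmn ih =>
    rw [← Finset.insert_Ico_right_eq_Ico_add_one hmn, Finset.sum_insert (by simp), hG, ← ih,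
      add_comm (b n), add_assoc]

/-- Telescoping over `ℤ` in `[0, ∞]`. -/
theorem tsum_int_eq_iSup_of_succ {G b : ℤ → ℝ≥0∞} (hG : ∀ j, G (j + 1) = G j + b j)
    (h0 : Tendsto G atBot (nhds 0)) : ∑' j, b j = ⨆ j, G j := by
  apply le_antisymm
  · rw [ENNReal.tsum_eq_iSup_sum]
    refine iSup_le fun s => ?_
    obtain ⟨m, hm⟩ := s.bddBelow
    obtain ⟨n, hn⟩ := s.bddAbove
    have hsub : s ⊆ Finset.Ico m (max m (n + 1)) := fun i hi =>
      Finset.mem_Ico.2 ⟨hm hi, lt_max_of_lt_right (Int.lt_add_one_iff.2 (hn hi))⟩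
    calc ∑ i ∈ s, b i ≤ ∑ i ∈ Finset.Ico m (max m (n + 1)), b i :=
          Finset.sum_le_sum_of_subset hsub
      _ ≤ G m + ∑ i ∈ Finset.Ico m (max m (n + 1)), b i := le_add_self
      _ = G (max m (n + 1)) := add_sum_Ico_eq_of_succ hG (le_max_left _ _)
      _ ≤ ⨆ j, G j := le_iSup G _
  · refine iSup_le fun n => ?_
    have hlim : Tendsto (fun m => G m + ∑' j, b j) atBot (nhds (∑' j, b j)) := by
      simpa using h0.add_const (∑' j, b j)
    refine ge_of_tendsto hlim ((eventually_le_atBot n).mono fun m hmn => ?_)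
    rw [← add_sum_Ico_eq_of_succ hG hmn]
    gcongr
    exact ENNReal.sum_le_tsum _

/-- A monotone family eventually within every relative error of `a` has supremum `a`. -/
theorem iSup_eq_of_relative_error {G : ℤ → ℝ≥0∞} (hmono : Monotone G) {a : ℝ≥0∞} (ha : a ≠ ∞)
    (hnear : ∀ ε : ℝ, 0 < ε → ∃ J : ℤ, ∀ j : ℤ, J ≤ j →
      ENNReal.ofReal (1 - ε) * a ≤ G j ∧ G j ≤ ENNReal.ofReal (1 + ε) * a) :
    ⨆ j, G j = a := by
  have hlim : ∀ φ : ℝ → ℝ, Continuous φ → φ 0 = 1 →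
      Tendsto (fun ε => ENNReal.ofReal (φ ε) * a) (nhdsWithin 0 (Set.Ioi 0)) (nhds a) := by
    intro φ hφ h1
    have hc : Continuous fun ε => ENNReal.ofReal (φ ε) * a :=
      (ENNReal.continuous_mul_const ha).comp (ENNReal.continuous_ofReal.comp hφ)
    simpa [h1] using (hc.tendsto 0).mono_left nhdsWithin_le_nhds
  apply le_antisymm
  · refine iSup_le fun j => ge_of_tendsto (hlim (fun ε => 1 + ε) (by fun_prop) (by simp))
      (eventually_mem_nhdsWithin.mono fun ε hε => ?_)
    obtain ⟨J, hJ⟩ := hnear ε hε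
    exact (hmono (le_max_left j J)).trans (hJ _ (le_max_right j J)).2
  · refine le_of_tendsto (hlim (fun ε => 1 - ε) (by fun_prop) (by simp))
      (eventually_mem_nhdsWithin.mono fun ε hε => ?_)
    obtain ⟨J, hJ⟩ := hnear ε hε
    exact (hJ J le_rfl).1.trans (le_iSup G J)

/-- The abstract telescoping argument behind the unitary extension principle:
the one-step splitting identity, near-Parseval bounds at large levels on a dense subset, and
vanishing at `j → -∞` imply that the combined family `(h_{j,ℓ,k})` is a Parseval frame. -/
theorem parseval_frame_of_telescoping {H : Type*} [NormedAddCommGroup H]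
    [InnerProductSpace ℂ H] [CompleteSpace H] (L : ℕ) (hL : 1 ≤ L)
    (g : ℤ → ℕ → H) (h : ℤ → ℕ → ℕ → H)
    (hsplit : ∀ f : H, ∀ j : ℤ,
      ∑' k : ℕ, ((‖⟪f, g j k⟫_ℂ‖₊ : ℝ≥0∞) ^ 2) =
        (∑' k : ℕ, ((‖⟪f, g (j - 1) k⟫_ℂ‖₊ : ℝ≥0∞) ^ 2)) +
          ∑ ℓ ∈ Finset.Icc 1 L, ∑' k : ℕ, ((‖⟪f, h (j - 1) ℓ k⟫_ℂ‖₊ : ℝ≥0∞) ^ 2))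
    (V : Set H) (hV : Dense V)
    (hnear : ∀ f ∈ V, ∀ ε : ℝ, 0 < ε → ∃ J : ℤ, ∀ j : ℤ, J ≤ j →
      ENNReal.ofReal (1 - ε) * (‖f‖₊ : ℝ≥0∞) ^ 2 ≤
          ∑' k : ℕ, ((‖⟪f, g j k⟫_ℂ‖₊ : ℝ≥0∞) ^ 2) ∧
        ∑' k : ℕ, ((‖⟪f, g j k⟫_ℂ‖₊ : ℝ≥0∞) ^ 2) ≤
          ENNReal.ofReal (1 + ε) * (‖f‖₊ : ℝ≥0∞) ^ 2)
    (hvanish : ∀ f : H,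
      Tendsto (fun j : ℤ => ∑' k : ℕ, ((‖⟪f, g j k⟫_ℂ‖₊ : ℝ≥0∞) ^ 2)) atBot (nhds 0)) :
    ∀ f : H,
      ∑' j : ℤ, ∑ ℓ ∈ Finset.Icc 1 L, ∑' k : ℕ, ((‖⟪f, h j ℓ k⟫_ℂ‖₊ : ℝ≥0∞) ^ 2) =
        (‖f‖₊ : ℝ≥0∞) ^ 2 := by
  intro f
  have hsucc : ∀ x : H, ∀ j : ℤ, ∑' k, ‖⟪x, g (j + 1) k⟫_ℂ‖ₑ ^ 2 =
      ∑' k, ‖⟪x, g j k⟫_ℂ‖ₑ ^ 2 +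
        ∑ ℓ ∈ Finset.Icc 1 L, ∑' k, ‖⟪x, h j ℓ k⟫_ℂ‖ₑ ^ 2 := by
    intro x j
    have := hsplit x (j + 1)
    rwa [add_sub_cancel_right] at this
  refine (tsum_int_eq_iSup_of_succ (hsucc f) (hvanish f)).trans ?_
  refine iSup_tsum_enorm_inner_sq_eq_of_dense g hV (fun v hv => ?_) f
  refine iSup_eq_of_relative_error (monotone_int_of_le_succ fun j => ?_)
    (ENNReal.pow_lt_top enorm_lt_top).ne (hnear v hv)
  rw [hsucc v j]
  exact le_self_add
end

section
/- Let X be a set, let a : X → X be a map, let L ≥ 1 be an integer, let m₀, …, m_L : X → ℂ and Ψ : X → ℂ be functions, and let φ : X → ℝ satisfy φ(ξ) > 0 for all ξ ∈ X. Assume that for every ξ ∈ X: Ψ(a(ξ)) = m₀(ξ)·Ψ(ξ) and φ(a(ξ))·|m₀(ξ)|² + ∑_{ℓ=1}^{L} |m_ℓ(ξ)|² = φ(ξ). Define Ψ̃(ξ) = √(φ(ξ))·Ψ(ξ), m̃₀(ξ) = √(φ(a(ξ))/φ(ξ))·m₀(ξ), and m̃_ℓ(ξ) = m_ℓ(ξ)/√(φ(ξ))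 for 1 ≤ ℓ ≤ L. Then for every ξ ∈ X: (a) Ψ̃(a(ξ)) = m̃₀(ξ)·Ψ̃(ξ); (b) ∑_{ℓ=0}^{L} |m̃_ℓ(ξ)|² = 1; and (c) m̃_ℓ(ξ)·Ψ̃(ξ) = m_ℓ(ξ)·Ψ(ξ) for each 1 ≤ ℓ ≤ L. -/
/-- The rescaling lemma behind the oblique extension principle: rescaling the
refinable data `(Ψ, m₀, …, m_L)` by a strictly positive function `φ` satisfying the oblique
identity produces data `(Ψ̃, m̃₀, …, m̃_L)` satisfying the refinement equation, the unitary
mask identity `∑ℓ |m̃ℓ|² = 1`, and `m̃ℓ·Ψ̃ = mℓ·Ψ` for `1 ≤ ℓ ≤ L`. -/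
theorem oblique_rescaling {X : Type*} (a : X → X) (L : ℕ) (hL : 1 ≤ L)
    (m : ℕ → X → ℂ) (Ψ : X → ℂ) (φ : X → ℝ) (hφ : ∀ ξ, 0 < φ ξ)
    (hrefine : ∀ ξ, Ψ (a ξ) = m 0 ξ * Ψ ξ)
    (hoblique : ∀ ξ, φ (a ξ) * ‖m 0 ξ‖ ^ 2 + ∑ ℓ ∈ Finset.Icc 1 L, ‖m ℓ ξ‖ ^ 2 = φ ξ)
    (Ψt : X → ℂ) (hΨt : ∀ ξ, Ψt ξ = (Real.sqrt (φ ξ) : ℂ) * Ψ ξ)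
    (mt : ℕ → X → ℂ)
    (hmt0 : ∀ ξ, mt 0 ξ = (Real.sqrt (φ (a ξ) / φ ξ) : ℂ) * m 0 ξ)
    (hmtℓ : ∀ ℓ, 1 ≤ ℓ → ℓ ≤ L → ∀ ξ, mt ℓ ξ = m ℓ ξ / (Real.sqrt (φ ξ) : ℂ)) :
    (∀ ξ, Ψt (a ξ) = mt 0 ξ * Ψt ξ) ∧
      (∀ ξ, ∑ ℓ ∈ Finset.range (L + 1), ‖mt ℓ ξ‖ ^ 2 = 1) ∧
        (∀ ℓ, 1 ≤ ℓ → ℓ ≤ L → ∀ ξ, mt ℓ ξ * Ψt ξ = m ℓ ξ * Ψ ξ) := by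
  have hsqrt : ∀ ξ, (Real.sqrt (φ ξ) : ℂ) ≠ 0 := fun ξ =>
    Complex.ofReal_ne_zero.mpr (Real.sqrt_pos.mpr (hφ ξ)).ne'
  refine ⟨fun ξ => ?_, fun ξ => ?_, fun ℓ h1 hL' ξ => ?_⟩
  · have := hsqrt ξ
    rw [hΨt, hΨt, hmt0, hrefine, Real.sqrt_div (hφ (a ξ)).le, Complex.ofReal_div]
    field_simp
  · have h0 : ‖mt 0 ξ‖ ^ 2 = φ (a ξ) * ‖m 0 ξ‖ ^ 2 / φ ξ := by
      rw [hmt0, norm_mul, mul_pow, Complex.norm_real, Real.norm_eq_abs, sq_abs,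
        Real.sq_sqrt (div_pos (hφ (a ξ)) (hφ ξ)).le, div_mul_eq_mul_div]
    have hsum : ∑ ℓ ∈ Finset.Icc 1 L, ‖mt ℓ ξ‖ ^ 2
        = (∑ ℓ ∈ Finset.Icc 1 L, ‖m ℓ ξ‖ ^ 2) / φ ξ := by
      rw [Finset.sum_div]
      refine Finset.sum_congr rfl fun ℓ hℓ => ?_
      obtain ⟨h1, hL'⟩ := Finset.mem_Icc.mp hℓ
      rw [hmtℓ ℓ h1 hL', norm_div, div_pow, Complex.norm_real, Real.norm_eq_abs, sq_abs,
        Real.sq_sqrt (hφ ξ).le]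
    rw [Finset.range_eq_Ico, Finset.sum_eq_sum_Ico_succ_bot L.succ_pos]
    change _ + ∑ ℓ ∈ Finset.Icc 1 L, ‖mt ℓ ξ‖ ^ 2 = 1
    rw [h0, hsum, ← add_div, hoblique, div_self (hφ ξ).ne']
  · have := hsqrt ξ
    rw [hΨt, hmtℓ ℓ h1 hL']
    field_simp
end
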